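/- Let Λ* ⊆ (F⁺_d)^N be a factorial language and let ∅ ≠ F ⊆ [N]. Then { a ∈ A : a Q_F = 0 } ⊆ I_F. Moreover, Q_F ∈ A if and only if I_F = { a(I − Q_F) : a ∈ A }. -/

import Mathlib

open scoped ENNReal

/-- The `N`-fold direct product of the free monoid on `d` generators,
with coordinatewise multiplication. -/
abbrev MWord (d N : ℕ) : Type := Fin N → FreeMonoid (Fin d)

/-- The element of `(F⁺_d)^N` whose `i`-th coordinate is the one-letter word `k`
and whose other coordinates are empty. -/
def delta (d N : ℕ) (i : Fin N) (k : Fin d) : MWord d N :=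
  fun j => if j = i then FreeMonoid.of k else 1

/-- `ν` is a factor of `μ` if `μ = w * ν * q` for some `w, q`. -/
def IsFactor {d N : ℕ} (ν μ : MWord d N) : Prop :=
  ∃ w q : MWord d N, μ = w * ν * q

/-- A factorial language in `(F⁺_d)^N`. -/
def IsFL {d N : ℕ} (Λ : Set (MWord d N)) : Prop :=
  (∀ i : Fin N, ∃ k : Fin d, delta d N i k ∈ Λ) ∧
  ∀ μ ∈ Λ, ∀ ν : MWord d N, IsFactor ν μ → ν ∈ Λ

/-- The multilength of a multiword. -/
def mlen {d N : ℕ} (μ : MWord d N) : Fin N → ℕ := fun i => (μ i).length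

/-- The support of a multiword. -/
def msupp {d N : ℕ} (μ : MWord d N) : Set (Fin N) := {i | μ i ≠ 1}

noncomputable section

/-- The Hilbert space `ℓ²(Λ*)`. -/
abbrev ell2 {d N : ℕ} (Λ : Set (MWord d N)) : Type := lp (fun _ : Λ => ℂ) 2

/-- The standard orthonormal basis vector `e_w̄` of `ℓ²(Λ*)`. -/
def evec {d N : ℕ} (Λ : Set (MWord d N)) (w : Λ) : ell2 Λ :=
  letI := Classical.decEq (↥Λ)
  lp.single 2 w 1

end

noncomputable section

/-- The C*-algebra of checkers of a factorial language: the unital commutative C*-subalgebra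
of `B(ℓ²(Λ*))` generated by the projections `T_μ̄* T_μ̄`, `μ̄ ∈ Λ*`. -/
def checkers {d N : ℕ} (Λ : Set (MWord d N)) (T : MWord d N → (ell2 Λ →L[ℂ] ell2 Λ)) :
    StarSubalgebra ℂ (ell2 Λ →L[ℂ] ell2 Λ) :=
  (StarAlgebra.adjoin ℂ {x : ell2 Λ →L[ℂ] ell2 Λ | ∃ μ ∈ Λ, x = star (T μ) * T μ}).topologicalClosure

/-- `P_i = Σ_{k∈[d]} T_{δ_i(k)} T_{δ_i(k)}*`. -/
def Pproj {d N : ℕ} (Λ : Set (MWord d N)) (T : MWord d N → (ell2 Λ →L[ℂ] ell2 Λ))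
    (i : Fin N) : ell2 Λ →L[ℂ] ell2 Λ :=
  ∑ k : Fin d, T (delta d N i k) * star (T (delta d N i k))

/-- `Q_F = Π_{i∈F} (I − P_i)`, the product taken in the increasing order of `[N]`
(the factors pairwise commute, so the order is immaterial); `Q_∅ = I`. -/
def Qproj {d N : ℕ} (Λ : Set (MWord d N)) (T : MWord d N → (ell2 Λ →L[ℂ] ell2 Λ))
    (F : Finset (Fin N)) : ell2 Λ →L[ℂ] ell2 Λ :=
  ((List.finRange N).filter (· ∈ F)).foldr (fun i acc => (1 - Pproj Λ T i) * acc) 1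

/-- `K_F = { a ∈ A : α_{δ_i(k)}(a) = 0 for all i ∈ F, k ∈ [d] }`. -/
def Kset {d N : ℕ} (Λ : Set (MWord d N)) (T : MWord d N → (ell2 Λ →L[ℂ] ell2 Λ))
    (F : Finset (Fin N)) : Set (ell2 Λ →L[ℂ] ell2 Λ) :=
  {a | a ∈ checkers Λ T ∧
    ∀ i ∈ F, ∀ k : Fin d, star (T (delta d N i k)) * a * T (delta d N i k) = 0}

/-- `J_F = { a ∈ A : a b = 0 for all b ∈ K_F }`. -/
def Jset {d N : ℕ} (Λ : Set (MWord d N)) (T : MWord d N → (ell2 Λ →L[ℂ] ell2 Λ))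
    (F : Finset (Fin N)) : Set (ell2 Λ →L[ℂ] ell2 Λ) :=
  {a | a ∈ checkers Λ T ∧ ∀ b ∈ Kset Λ T F, a * b = 0}

/-- `I_F = { a ∈ J_F : α_μ̄(a) ∈ J_F for all μ̄ ∈ Λ* with supp μ̄ ∩ F = ∅ }`. -/
def Iset {d N : ℕ} (Λ : Set (MWord d N)) (T : MWord d N → (ell2 Λ →L[ℂ] ell2 Λ))
    (F : Finset (Fin N)) : Set (ell2 Λ →L[ℂ] ell2 Λ) :=
  {a | a ∈ Jset Λ T F ∧
    ∀ μ ∈ Λ, msupp μ ∩ (↑F : Set (Fin N)) = ∅ → star (T μ) * a * T μ ∈ Jset Λ T F}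

end

section BasisVectors

variable {d N : ℕ} {Λ : Set (MWord d N)}

theorem inner_evec_left (w : Λ) (x : ell2 Λ) : inner ℂ (evec Λ w) x = x w := by
  let := Classical.decEq Λ
  rw [evec, lp.inner_single_left]
  simp

theorem evec_apply_self (w : Λ) : evec Λ w w = 1 := by
  simp [evec]

theorem evec_apply_ne {w v : Λ} (h : v ≠ w) : evec Λ w v = 0 := by
  simp [evec, h]

theorem evec_ne_zero (w : Λ) : evec Λ w ≠ 0 := fun h => by
  simpa [h] using evec_apply_self w

theorem clm_ext_evec {a b : ell2 Λ →L[ℂ] ell2 Λ} (h : ∀ w, a (evec Λ w) = b (evec Λ w)) :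
    a = b := by
  let := Classical.decEq Λ
  refine lp.ext_continuousLinearMap (ENNReal.ofNat_ne_top (n := nat_lit 2)) fun w => ?_
  ext1
  simpa [evec] using h w

theorem star_apply_evec_apply (a : ell2 Λ →L[ℂ] ell2 Λ) (w v : Λ) :
    (star a (evec Λ w)) v = star ((a (evec Λ v)) w) := by
  rw [← inner_evec_left, ContinuousLinearMap.star_eq_adjoint,
    ContinuousLinearMap.adjoint_inner_right, ← inner_conj_symm, inner_evec_left]
  rfl

end BasisVectors

section DiagonalOperators

variable {d N : ℕ} {Λ : Set (MWord d N)}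

/-- The star subalgebra of operators that are diagonal in the standard basis. -/
def diagonalOperators (Λ : Set (MWord d N)) : StarSubalgebra ℂ (ell2 Λ →L[ℂ] ell2 Λ) where
  carrier := {a | ∀ w, ∃ c : ℂ, a (evec Λ w) = c • evec Λ w}
  mul_mem' {a b} ha hb w := by
    obtain ⟨c, hc⟩ := ha w
    obtain ⟨c', hc'⟩ := hb w
    exact ⟨c' * c, by simp [hc, hc', smul_smul]⟩
  add_mem' {a b} ha hb w := by
    obtain ⟨c, hc⟩ := ha w
    obtain ⟨c', hc'⟩ := hb w
    exact ⟨c + c', by simp [hc, hc', add_smul]⟩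
  algebraMap_mem' r w := ⟨r, by simp [Algebra.algebraMap_eq_smul_one]⟩
  star_mem' {a} ha w := by
    refine ⟨(star a (evec Λ w)) w, lp.ext (funext fun v => ?_)⟩
    by_cases hv : v = w
    · subst hv
      simp [evec_apply_self]
    · obtain ⟨c, hc⟩ := ha v
      rw [star_apply_evec_apply, hc]
      simp [evec_apply_ne hv, evec_apply_ne (Ne.symm hv)]

theorem mem_diagonalOperators {a : ell2 Λ →L[ℂ] ell2 Λ} :
    a ∈ diagonalOperators Λ ↔ ∀ w, ∃ c : ℂ, a (evec Λ w) = c • evec Λ w :=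
  Iff.rfl

theorem diagonalOperators_mul_comm {a b : ell2 Λ →L[ℂ] ell2 Λ} (ha : a ∈ diagonalOperators Λ)
    (hb : b ∈ diagonalOperators Λ) : a * b = b * a := by
  refine clm_ext_evec fun w => ?_
  obtain ⟨c, hc⟩ := ha w
  obtain ⟨c', hc'⟩ := hb w
  simp [hc, hc', smul_smul, mul_comm]

theorem isClosed_diagonalOperators :
    IsClosed (diagonalOperators Λ : Set (ell2 Λ →L[ℂ] ell2 Λ)) := by
  have : (diagonalOperators Λ : Set (ell2 Λ →L[ℂ] ell2 Λ)) =
      ⋂ w, (fun a : ell2 Λ →L[ℂ] ell2 Λ => a (evec Λ w)) ⁻¹' (ℂ ∙ evec Λ w) := by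
    ext a
    simp [mem_diagonalOperators, Submodule.mem_span_singleton, eq_comm]
  rw [this]
  exact isClosed_iInter fun w =>
    (Submodule.closed_of_finiteDimensional _).preimage (by fun_prop)

end DiagonalOperators

/-- `T` is the family of left creation operators of `Λ`. -/
structure IsCreationFamily {d N : ℕ} (Λ : Set (MWord d N))
    (T : MWord d N → (ell2 Λ →L[ℂ] ell2 Λ)) : Prop where
  apply_of_mem : ∀ (μ : MWord d N) (w : Λ) (h : μ * (w : MWord d N) ∈ Λ),
    T μ (evec Λ w) = evec Λ ⟨μ * (w : MWord d N), h⟩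
  apply_of_notMem : ∀ (μ : MWord d N) (w : Λ), μ * (w : MWord d N) ∉ Λ → T μ (evec Λ w) = 0

namespace IsFL

variable {d N : ℕ} {Λ : Set (MWord d N)}

theorem right_mem (hΛ : IsFL Λ) {μ ν : MWord d N} (h : μ * ν ∈ Λ) : ν ∈ Λ :=
  hΛ.2 _ h _ ⟨μ, 1, by simp⟩

theorem left_mem (hΛ : IsFL Λ) {μ ν : MWord d N} (h : μ * ν ∈ Λ) : μ ∈ Λ :=
  hΛ.2 _ h _ ⟨1, ν, by simp⟩

end IsFL

section Words

variable {d N : ℕ}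

theorem delta_mul_apply_self (i : Fin N) (k : Fin d) (w : MWord d N) :
    (delta d N i k * w) i = FreeMonoid.of k * w i := by
  simp [delta]

theorem of_mul_ne_one {α : Type*} (k : α) (w : FreeMonoid α) : FreeMonoid.of k * w ≠ 1 := by
  intro h
  simpa using congrArg FreeMonoid.length h

theorem exists_eq_delta_mul {w : MWord d N} {i : Fin N} (hw : w i ≠ 1) :
    ∃ (k : Fin d) (v : MWord d N), w = delta d N i k * v := by
  obtain ⟨k, t, hkt⟩ : ∃ k t, w i = FreeMonoid.of k * t := by
    cases h : w i using FreeMonoid.casesOn with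
    | one => exact absurd h hw
    | of_mul k t => exact ⟨k, t, rfl⟩
  refine ⟨k, Function.update w i t, funext fun j => ?_⟩
  by_cases hj : j = i
  · subst hj
    simp [delta, hkt]
  · simp [delta, hj]

theorem delta_mul_inj_letter {i : Fin N} {k l : Fin d} {v w : MWord d N}
    (h : delta d N i k * v = delta d N i l * w) : k = l := by
  have h' := congrFun h i
  rw [delta_mul_apply_self, delta_mul_apply_self] at h'
  exact (List.cons.inj h').1

end Words

namespace IsCreationFamily

variable {d N : ℕ} {Λ : Set (MWord d N)} {T : MWord d N → (ell2 Λ →L[ℂ] ell2 Λ)}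

theorem star_apply_mul (hT : IsCreationFamily Λ T) (μ : MWord d N) (w : Λ)
    (h : μ * (w : MWord d N) ∈ Λ) :
    star (T μ) (evec Λ ⟨μ * (w : MWord d N), h⟩) = evec Λ w := by
  refine lp.ext (funext fun v => ?_)
  rw [star_apply_evec_apply]
  by_cases hv : μ * (v : MWord d N) ∈ Λ
  · rw [hT.apply_of_mem μ v hv]
    by_cases hvw : v = w
    · subst hvw
      simp [evec_apply_self]
    · rw [evec_apply_ne hvw, evec_apply_ne, star_zero]
      intro h'
      exact hvw (Subtype.ext (mul_left_cancel (Subtype.ext_iff.1 h').symm))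
  · rw [hT.apply_of_notMem μ v hv, evec_apply_ne]
    · simp
    · rintro rfl
      exact hv h

theorem star_apply_of_ne (hT : IsCreationFamily Λ T) (μ : MWord d N) (w : Λ)
    (h : ∀ v : MWord d N, μ * v ≠ w) : star (T μ) (evec Λ w) = 0 := by
  refine lp.ext (funext fun v => ?_)
  rw [star_apply_evec_apply]
  by_cases hv : μ * (v : MWord d N) ∈ Λ
  · rw [hT.apply_of_mem μ v hv, evec_apply_ne]
    · simp
    · rintro rfl
      exact h _ rfl
  · simp [hT.apply_of_notMem μ v hv]

theorem star_mul_self_mem_diagonalOperators (hT : IsCreationFamily Λ T) (μ : MWord d N) :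
    star (T μ) * T μ ∈ diagonalOperators Λ := by
  intro w
  by_cases hw : μ * (w : MWord d N) ∈ Λ
  · exact ⟨1, by simp [hT.apply_of_mem μ w hw, hT.star_apply_mul μ w hw]⟩
  · exact ⟨0, by simp [hT.apply_of_notMem μ w hw]⟩

theorem mul_star_self_mem_diagonalOperators (hT : IsCreationFamily Λ T) (hΛ : IsFL Λ)
    (μ : MWord d N) : T μ * star (T μ) ∈ diagonalOperators Λ := by
  rintro ⟨w, hw⟩
  by_cases h : ∃ v, μ * v = w
  · obtain ⟨v, rfl⟩ := h
    have hv : v ∈ Λ := hΛ.right_mem hw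
    exact ⟨1, by simp [hT.star_apply_mul μ ⟨v, hv⟩ hw, hT.apply_of_mem μ ⟨v, hv⟩ hw]⟩
  · exact ⟨0, by simp [hT.star_apply_of_ne μ ⟨w, hw⟩ (not_exists.1 h)]⟩

theorem mul_star_mul_self (hT : IsCreationFamily Λ T) (μ : MWord d N) :
    T μ * star (T μ) * T μ = T μ := by
  refine clm_ext_evec fun w => ?_
  by_cases hw : μ * (w : MWord d N) ∈ Λ
  · simp [hT.apply_of_mem μ w hw, hT.star_apply_mul μ w hw]
  · simp [hT.apply_of_notMem μ w hw]

theorem mul_eq (hT : IsCreationFamily Λ T) (hΛ : IsFL Λ) (ν μ : MWord d N) :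
    T ν * T μ = T (ν * μ) := by
  refine clm_ext_evec fun w => ?_
  by_cases hw : ν * μ * (w : MWord d N) ∈ Λ
  · have hw' : ν * (μ * (w : MWord d N)) ∈ Λ := by rwa [← mul_assoc]
    have hμ : μ * (w : MWord d N) ∈ Λ := hΛ.right_mem hw'
    simp [hT.apply_of_mem μ w hμ, hT.apply_of_mem (ν * μ) w hw,
      hT.apply_of_mem ν ⟨_, hμ⟩ hw', mul_assoc]
  · rw [hT.apply_of_notMem _ w hw]
    by_cases hμ : μ * (w : MWord d N) ∈ Λ
    · have hw' : ν * ((⟨_, hμ⟩ : Λ) : MWord d N) ∉ Λ := by rwa [← mul_assoc]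
      simp [hT.apply_of_mem μ w hμ, hT.apply_of_notMem ν ⟨_, hμ⟩ hw']
    · simp [hT.apply_of_notMem μ w hμ]

theorem eq_zero_of_notMem (hT : IsCreationFamily Λ T) (hΛ : IsFL Λ) {μ : MWord d N}
    (hμ : μ ∉ Λ) : T μ = 0 :=
  clm_ext_evec fun w => by simp [hT.apply_of_notMem μ w fun h => hμ (hΛ.left_mem h)]

theorem star_mul_self_mem_adjoin (hT : IsCreationFamily Λ T) (hΛ : IsFL Λ) (μ : MWord d N) :
    star (T μ) * T μ ∈ StarAlgebra.adjoin ℂ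
      {x : ell2 Λ →L[ℂ] ell2 Λ | ∃ μ ∈ Λ, x = star (T μ) * T μ} := by
  by_cases hμ : μ ∈ Λ
  · exact StarAlgebra.subset_adjoin ℂ _ ⟨μ, hμ, rfl⟩
  · simp [hT.eq_zero_of_notMem hΛ hμ]

theorem adjoin_le_diagonalOperators (hT : IsCreationFamily Λ T) :
    StarAlgebra.adjoin ℂ {x : ell2 Λ →L[ℂ] ell2 Λ | ∃ μ ∈ Λ, x = star (T μ) * T μ} ≤
      diagonalOperators Λ := by
  refine StarAlgebra.adjoin_le ?_
  rintro _ ⟨μ, -, rfl⟩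
  exact hT.star_mul_self_mem_diagonalOperators μ

theorem checkers_le_diagonalOperators (hT : IsCreationFamily Λ T) :
    checkers Λ T ≤ diagonalOperators Λ :=
  StarSubalgebra.topologicalClosure_minimal hT.adjoin_le_diagonalOperators
    isClosed_diagonalOperators

theorem compress_mul (hT : IsCreationFamily Λ T) (hΛ : IsFL Λ) (μ : MWord d N)
    (a : ell2 Λ →L[ℂ] ell2 Λ) {b : ell2 Λ →L[ℂ] ell2 Λ} (hb : b ∈ diagonalOperators Λ) :
    star (T μ) * (a * b) * T μ = (star (T μ) * a * T μ) * (star (T μ) * b * T μ) :=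
  calc star (T μ) * (a * b) * T μ
      = star (T μ) * (a * b) * (T μ * star (T μ) * T μ) := by rw [hT.mul_star_mul_self]
    _ = star (T μ) * a * (b * (T μ * star (T μ))) * T μ := by simp only [mul_assoc]
    _ = (star (T μ) * a * T μ) * (star (T μ) * b * T μ) := by
        rw [diagonalOperators_mul_comm hb (hT.mul_star_self_mem_diagonalOperators hΛ μ)]
        simp only [mul_assoc]

theorem compress_mem_adjoin (hT : IsCreationFamily Λ T) (hΛ : IsFL Λ) (μ : MWord d N)
    {a : ell2 Λ →L[ℂ] ell2 Λ}
    (ha : a ∈ StarAlgebra.adjoin ℂ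
      {x : ell2 Λ →L[ℂ] ell2 Λ | ∃ μ ∈ Λ, x = star (T μ) * T μ}) :
    star (T μ) * a * T μ ∈ StarAlgebra.adjoin ℂ
      {x : ell2 Λ →L[ℂ] ell2 Λ | ∃ μ ∈ Λ, x = star (T μ) * T μ} := by
  induction ha using StarAlgebra.adjoin_induction with
  | mem x hx =>
    obtain ⟨ν, -, rfl⟩ := hx
    convert hT.star_mul_self_mem_adjoin hΛ (ν * μ) using 1
    rw [← hT.mul_eq hΛ, star_mul]
    simp only [mul_assoc]
  | algebraMap r =>
    rw [Algebra.algebraMap_eq_smul_one, mul_smul_comm, mul_one, smul_mul_assoc]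
    exact SMulMemClass.smul_mem r (hT.star_mul_self_mem_adjoin hΛ μ)
  | add x y _ _ hx hy =>
    rw [mul_add, add_mul]
    exact add_mem hx hy
  | mul x y _ hy' hx hy =>
    rw [hT.compress_mul hΛ μ x (hT.adjoin_le_diagonalOperators hy')]
    exact mul_mem hx hy
  | star x _ hx =>
    convert star_mem hx using 1
    simp [mul_assoc]

theorem compress_mem_checkers (hT : IsCreationFamily Λ T) (hΛ : IsFL Λ) (μ : MWord d N)
    {a : ell2 Λ →L[ℂ] ell2 Λ} (ha : a ∈ checkers Λ T) :
    star (T μ) * a * T μ ∈ checkers Λ T :=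
  map_mem_closure (f := fun a => star (T μ) * a * T μ) (by fun_prop) ha
    fun _ => hT.compress_mem_adjoin hΛ μ

theorem Pproj_apply_of_eq_one (hT : IsCreationFamily Λ T) {i : Fin N} {w : Λ}
    (hw : (w : MWord d N) i = 1) : Pproj Λ T i (evec Λ w) = 0 := by
  rw [Pproj, sum_apply]
  refine Finset.sum_eq_zero fun k _ => ?_
  rw [mul_apply_eq_comp, hT.star_apply_of_ne, map_zero]
  intro v hv
  rw [← hv, delta_mul_apply_self] at hw
  exact of_mul_ne_one _ _ hw

theorem Pproj_apply_of_ne_one (hT : IsCreationFamily Λ T) (hΛ : IsFL Λ) {i : Fin N} {w : Λ}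
    (hw : (w : MWord d N) i ≠ 1) : Pproj Λ T i (evec Λ w) = evec Λ w := by
  obtain ⟨w, hwΛ⟩ := w
  obtain ⟨k, v, rfl⟩ := exists_eq_delta_mul hw
  have hv : v ∈ Λ := hΛ.right_mem hwΛ
  rw [Pproj, sum_apply, Finset.sum_eq_single k]
  · rw [mul_apply_eq_comp, hT.star_apply_mul _ ⟨v, hv⟩ hwΛ,
      hT.apply_of_mem _ ⟨v, hv⟩ hwΛ]
  · intro l _ hl
    rw [mul_apply_eq_comp, hT.star_apply_of_ne, map_zero]
    exact fun u hu => hl (delta_mul_inj_letter hu)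
  · simp

theorem foldr_Pproj_apply_of_forall_eq_one (hT : IsCreationFamily Λ T) (w : Λ)
    (l : List (Fin N)) (hl : ∀ i ∈ l, (w : MWord d N) i = 1) :
    l.foldr (fun i acc => (1 - Pproj Λ T i) * acc) 1 (evec Λ w) = evec Λ w := by
  induction l with
  | nil => simp
  | cons i l ih =>
    simp only [List.mem_cons, forall_eq_or_imp] at hl
    simp [ih hl.2, hT.Pproj_apply_of_eq_one hl.1]

theorem foldr_Pproj_apply_of_exists_ne_one (hT : IsCreationFamily Λ T) (hΛ : IsFL Λ) (w : Λ)
    (l : List (Fin N)) (hl : ∃ i ∈ l, (w : MWord d N) i ≠ 1) :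
    l.foldr (fun i acc => (1 - Pproj Λ T i) * acc) 1 (evec Λ w) = 0 := by
  induction l with
  | nil => simp at hl
  | cons i l ih =>
    by_cases h : ∃ i ∈ l, (w : MWord d N) i ≠ 1
    · simp [ih h]
    · have hi : (w : MWord d N) i ≠ 1 := by
        obtain ⟨j, hj, hjw⟩ := hl
        rcases List.mem_cons.1 hj with rfl | hj
        · exact hjw
        · exact absurd ⟨j, hj, hjw⟩ h
      push Not at h
      simp [hT.foldr_Pproj_apply_of_forall_eq_one w l h, hT.Pproj_apply_of_ne_one hΛ hi]

theorem Qproj_apply_of_forall_eq_one (hT : IsCreationFamily Λ T) {F : Finset (Fin N)} {w : Λ}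
    (hw : ∀ i ∈ F, (w : MWord d N) i = 1) : Qproj Λ T F (evec Λ w) = evec Λ w :=
  hT.foldr_Pproj_apply_of_forall_eq_one w _ (by simpa using hw)

theorem Qproj_apply_of_ne_one (hT : IsCreationFamily Λ T) (hΛ : IsFL Λ) {F : Finset (Fin N)}
    {w : Λ} {i : Fin N} (hi : i ∈ F) (hw : (w : MWord d N) i ≠ 1) :
    Qproj Λ T F (evec Λ w) = 0 :=
  hT.foldr_Pproj_apply_of_exists_ne_one hΛ w _ ⟨i, by simpa using hi, hw⟩

theorem mul_Qproj_eq_zero_iff (hT : IsCreationFamily Λ T) (hΛ : IsFL Λ) (F : Finset (Fin N))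
    (a : ell2 Λ →L[ℂ] ell2 Λ) :
    a * Qproj Λ T F = 0 ↔
      ∀ w : Λ, (∀ i ∈ F, (w : MWord d N) i = 1) → a (evec Λ w) = 0 := by
  refine ⟨fun h w hw => ?_, fun h => clm_ext_evec fun w => ?_⟩
  · simpa [hT.Qproj_apply_of_forall_eq_one hw] using congrArg (fun b => b (evec Λ w)) h
  · by_cases hw : ∀ i ∈ F, (w : MWord d N) i = 1
    · simp [hT.Qproj_apply_of_forall_eq_one hw, h w hw]
    · push Not at hw
      obtain ⟨i, hi, hw⟩ := hw
      simp [hT.Qproj_apply_of_ne_one hΛ hi hw]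

theorem Qproj_mul_self (hT : IsCreationFamily Λ T) (hΛ : IsFL Λ) (F : Finset (Fin N)) :
    Qproj Λ T F * Qproj Λ T F = Qproj Λ T F := by
  rw [← sub_eq_zero, ← sub_one_mul, ← neg_eq_zero, ← neg_mul, neg_sub,
    hT.mul_Qproj_eq_zero_iff hΛ]
  intro w hw
  simp [hT.Qproj_apply_of_forall_eq_one hw]

theorem Kset_apply_of_ne_one (hT : IsCreationFamily Λ T) (hΛ : IsFL Λ) {F : Finset (Fin N)}
    {b : ell2 Λ →L[ℂ] ell2 Λ} (hb : b ∈ Kset Λ T F) {i : Fin N} (hi : i ∈ F) {w : Λ}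
    (hw : (w : MWord d N) i ≠ 1) : b (evec Λ w) = 0 := by
  obtain ⟨c, hc⟩ := hT.checkers_le_diagonalOperators hb.1 w
  obtain ⟨w, hwΛ⟩ := w
  obtain ⟨k, v, rfl⟩ := exists_eq_delta_mul hw
  have hv : v ∈ Λ := hΛ.right_mem hwΛ
  have h := congrArg (fun x => x (evec Λ ⟨v, hv⟩)) (hb.2 i hi k)
  simp only [mul_apply_eq_comp, hT.apply_of_mem _ ⟨v, hv⟩ hwΛ, hc, map_smul,
    hT.star_apply_mul _ ⟨v, hv⟩ hwΛ, zero_apply, smul_eq_zero,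
    evec_ne_zero, or_false] at h
  rw [hc, h, zero_smul]

theorem mem_Jset_of_mul_Qproj_eq_zero (hT : IsCreationFamily Λ T) (hΛ : IsFL Λ)
    {F : Finset (Fin N)} {a : ell2 Λ →L[ℂ] ell2 Λ} (ha : a ∈ checkers Λ T)
    (haQ : a * Qproj Λ T F = 0) : a ∈ Jset Λ T F := by
  refine ⟨ha, fun b hb => clm_ext_evec fun w => ?_⟩
  by_cases hw : ∀ i ∈ F, (w : MWord d N) i = 1
  · rw [diagonalOperators_mul_comm (hT.checkers_le_diagonalOperators ha)
      (hT.checkers_le_diagonalOperators hb.1)]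
    simp [(hT.mul_Qproj_eq_zero_iff hΛ F a).1 haQ w hw]
  · push Not at hw
    obtain ⟨i, hi, hw⟩ := hw
    simp [hT.Kset_apply_of_ne_one hΛ hb hi hw]

theorem compress_mul_Qproj_eq_zero (hT : IsCreationFamily Λ T) (hΛ : IsFL Λ)
    {F : Finset (Fin N)} {a : ell2 Λ →L[ℂ] ell2 Λ} (haQ : a * Qproj Λ T F = 0)
    {μ : MWord d N} (hμ : msupp μ ∩ (↑F : Set (Fin N)) = ∅) :
    star (T μ) * a * T μ * Qproj Λ T F = 0 := by
  rw [hT.mul_Qproj_eq_zero_iff hΛ] at haQ ⊢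
  intro w hw
  by_cases h : μ * (w : MWord d N) ∈ Λ
  · have hμw : ∀ i ∈ F, (μ * (w : MWord d N)) i = 1 := by
      intro i hi
      have hμi : μ i = 1 := by
        by_contra hne
        exact Set.eq_empty_iff_forall_notMem.1 hμ i ⟨hne, hi⟩
      simp [hμi, hw i hi]
    simp [hT.apply_of_mem μ w h, haQ ⟨_, h⟩ hμw]
  · simp [hT.apply_of_notMem μ w h]

theorem mem_Iset_of_mul_Qproj_eq_zero (hT : IsCreationFamily Λ T) (hΛ : IsFL Λ)
    {F : Finset (Fin N)} {a : ell2 Λ →L[ℂ] ell2 Λ} (ha : a ∈ checkers Λ T)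
    (haQ : a * Qproj Λ T F = 0) : a ∈ Iset Λ T F :=
  ⟨hT.mem_Jset_of_mul_Qproj_eq_zero hΛ ha haQ, fun μ _ hμ =>
    hT.mem_Jset_of_mul_Qproj_eq_zero hΛ (hT.compress_mem_checkers hΛ μ ha)
      (hT.compress_mul_Qproj_eq_zero hΛ haQ hμ)⟩

theorem Qproj_mem_Kset (hT : IsCreationFamily Λ T) (hΛ : IsFL Λ) {F : Finset (Fin N)}
    (hQ : Qproj Λ T F ∈ checkers Λ T) : Qproj Λ T F ∈ Kset Λ T F := by
  refine ⟨hQ, fun i hi k => clm_ext_evec fun w => ?_⟩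
  by_cases h : delta d N i k * (w : MWord d N) ∈ Λ
  · have hne : (delta d N i k * (w : MWord d N)) i ≠ 1 := by
      rw [delta_mul_apply_self]
      exact of_mul_ne_one _ _
    simp [hT.apply_of_mem _ w h, hT.Qproj_apply_of_ne_one hΛ (w := ⟨_, h⟩) hi hne]
  · simp [hT.apply_of_notMem _ w h]

end IsCreationFamily

noncomputable section

/-- For a factorial language `Λ*` and `∅ ≠ F ⊆ [N]`: `{ a ∈ A : a Q_F = 0 } ⊆ I_F`.
Moreover `Q_F ∈ A` if and only if `I_F = { a (I − Q_F) : a ∈ A }`. -/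
theorem annihilator_of_Qproj_subset_Iset {d N : ℕ} (Λ : Set (MWord d N)) (hFL : IsFL Λ)
    (T : MWord d N → (ell2 Λ →L[ℂ] ell2 Λ))
    (hT1 : ∀ (μ : MWord d N) (w : Λ) (h : μ * (w : MWord d N) ∈ Λ),
      T μ (evec Λ w) = evec Λ ⟨μ * (w : MWord d N), h⟩)
    (hT2 : ∀ (μ : MWord d N) (w : Λ), μ * (w : MWord d N) ∉ Λ → T μ (evec Λ w) = 0)
    (F : Finset (Fin N)) (hF : F.Nonempty) :
    {a | a ∈ checkers Λ T ∧ a * Qproj Λ T F = 0} ⊆ Iset Λ T F ∧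
    (Qproj Λ T F ∈ checkers Λ T ↔
      Iset Λ T F = {x | ∃ a ∈ checkers Λ T, x = a * (1 - Qproj Λ T F)}) := by
  have hT : IsCreationFamily Λ T := ⟨hT1, hT2⟩
  refine ⟨fun a ha => hT.mem_Iset_of_mul_Qproj_eq_zero hFL ha.1 ha.2, fun hQ => ?_, fun h => ?_⟩
  · ext a
    refine ⟨fun ha => ⟨a, ha.1.1, ?_⟩, ?_⟩
    · rw [mul_sub, mul_one, ha.1.2 _ (hT.Qproj_mem_Kset hFL hQ), sub_zero]
    · rintro ⟨a, ha, rfl⟩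
      refine hT.mem_Iset_of_mul_Qproj_eq_zero hFL (mul_mem ha (sub_mem (one_mem _) hQ)) ?_
      rw [mul_assoc, sub_mul, one_mul, hT.Qproj_mul_self hFL, sub_self, mul_zero]
  · have h1 : 1 - Qproj Λ T F ∈ Iset Λ T F := by
      rw [h]
      exact ⟨1, one_mem _, (one_mul _).symm⟩
    simpa using sub_mem (one_mem (checkers Λ T)) h1.1.1

end
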